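/- arXiv:1704.08281 — 3 statements merged into one kernel-verified Lean document; each statement's English description precedes it below -/
import Mathlib

section
/- For every positive integer N and every real r ≥ 1, for Lebesgue almost every x ∈ [0,1) with N-continued fraction coefficients (a_k), the r-Hölder mean diverges: lim_{n→∞} ((1/n) Σ_{j=1}^n a_j^r)^{1/r} = +∞; equivalently (1/n) Σ_{j=1}^n a_j^r → ∞. -/
open MeasureTheory Filter Set

/-- The generalized Gauss transformation `T_N(x) = {N/x}` (and `T_N(0) = 0`). -/
noncomputable def gaussT (N : ℕ) (x : ℝ) : ℝ :=
  if x = 0 then 0 else Int.fract ((N : ℝ) / x)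

theorem measurable_gaussT (N : ℕ) : Measurable (gaussT N) := by
  unfold gaussT
  exact Measurable.ite (measurableSet_singleton 0) measurable_const
    (measurable_fract.comp (measurable_const.div measurable_id))

theorem gaussT_nonneg (N : ℕ) (x : ℝ) : 0 ≤ gaussT N x := by
  unfold gaussT
  split_ifs
  · exact le_rfl
  · exact Int.fract_nonneg _

theorem iterate_gaussT_nonneg (N : ℕ) {x : ℝ} (hx : 0 ≤ x) (j : ℕ) : 0 ≤ (gaussT N)^[j] x := by
  cases j with
  | zero => exact hx
  | succ j =>
    rw [Function.iterate_succ_apply']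
    exact gaussT_nonneg _ _

theorem measurable_floor_div (N : ℕ) : Measurable fun x : ℝ => (⌊(N : ℝ) / x⌋ : ℝ) :=
  (measurable_from_top (f := fun z : ℤ => (z : ℝ))).comp
    (Int.measurable_floor.comp (measurable_const.div measurable_id))

theorem measurable_birkhoffSum_floor (N n : ℕ) :
    Measurable (birkhoffSum (gaussT N) (fun x => (⌊(N : ℝ) / x⌋ : ℝ)) n) := by
  unfold birkhoffSum
  exact Finset.measurable_sum _ fun k _ =>
    (measurable_floor_div N).comp ((measurable_gaussT N).iterate k)

/-- The contribution of the inverse branch `y ↦ N / (m + y)` to the transfer operator of `gaussT`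
with respect to the density `1 / (N + x)`. -/
theorem lintegral_gaussT_branch {N : ℕ} (hN : 0 < N) (w : ℝ → ℝ) (g : ℝ → ENNReal) {m : ℕ}
    (hm : 0 < m) :
    ∫⁻ x in (fun y : ℝ => (N : ℝ) / (m + y)) '' Ico 0 1,
        ENNReal.ofReal (w ⌊(N : ℝ) / x⌋ / (N + x)) * g (gaussT N x) =
      ∫⁻ y in Ico (0 : ℝ) 1, ENNReal.ofReal (w m / ((m + y) * (m + y + 1))) * g y := by
  have hN' : (0 : ℝ) < N := by exact_mod_cast hN
  have hm' : (0 : ℝ) < m := by exact_mod_cast hm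
  have hderiv : ∀ y ∈ Ico (0 : ℝ) 1, HasDerivWithinAt (fun y : ℝ => (N : ℝ) / (m + y))
      (-(N / (m + y) ^ 2)) (Ico 0 1) y := by
    intro y hy
    have h : (m : ℝ) + y ≠ 0 := by linarith [hy.1]
    have := (((hasDerivAt_id y).const_add (m : ℝ)).inv h).const_mul (N : ℝ)
    refine (this.congr_deriv ?_).hasDerivWithinAt
    simp only [id]
    ring
  have hinj : InjOn (fun y : ℝ => (N : ℝ) / (m + y)) (Ico 0 1) := by
    intro y hy z hz h
    have h1 : 0 < (m : ℝ) + y := by linarith [hy.1]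
    have h2 : 0 < (m : ℝ) + z := by linarith [hz.1]
    simp only at h
    rw [div_eq_div_iff h1.ne' h2.ne'] at h
    linarith [mul_left_cancel₀ hN'.ne' h]
  rw [lintegral_image_eq_lintegral_abs_deriv_mul measurableSet_Ico hderiv hinj]
  refine setLIntegral_congr_fun measurableSet_Ico fun y hy => ?_
  have h1 : 0 < (m : ℝ) + y := by linarith [hy.1]
  have hdiv : (N : ℝ) / (N / (m + y)) = m + y := by field_simp
  have hfloor : ⌊(m : ℝ) + y⌋ = m := by
    rw [Int.floor_natCast_add, Int.floor_eq_zero_iff.2 hy, add_zero]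
  have hT : gaussT N (N / (m + y)) = y := by
    rw [gaussT, if_neg (by positivity), hdiv, Int.fract_natCast_add, Int.fract_eq_self.2 hy]
  simp only [hT, hdiv, hfloor, abs_neg, Int.cast_natCast]
  rw [← mul_assoc, ← ENNReal.ofReal_mul (abs_nonneg _), abs_of_pos (by positivity)]
  congr 2
  field_simp

theorem Ioo_subset_iUnion_gaussT_branch {N : ℕ} (hN : 0 < N) :
    Ioo (0 : ℝ) 1 ⊆ ⋃ k : ℕ, (fun y : ℝ => (N : ℝ) / ((N + k : ℕ) + y)) '' Ico 0 1 := by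
  intro x hx
  have hN' : (0 : ℝ) < N := by exact_mod_cast hN
  have hle : N ≤ ⌊(N : ℝ) / x⌋₊ := by
    apply Nat.le_floor
    rw [le_div_iff₀ hx.1]
    nlinarith [hx.2]
  obtain ⟨k, hk⟩ := Nat.exists_eq_add_of_le hle
  refine mem_iUnion.2 ⟨k, Int.fract ((N : ℝ) / x), ⟨Int.fract_nonneg _, Int.fract_lt_one _⟩, ?_⟩
  have h0 : 0 ≤ (N : ℝ) / x := by have := hx.1; positivity
  have hsum : ((N + k : ℕ) : ℝ) + Int.fract ((N : ℝ) / x) = N / x := by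
    rw [← hk, natCast_floor_eq_intCast_floor h0, Int.floor_add_fract]
  simp only [hsum]
  have := hx.1.ne'
  field_simp

theorem lintegral_gaussT_le {N : ℕ} (hN : 0 < N) {w : ℝ → ℝ} {g : ℝ → ENNReal}
    (hg : Measurable g) :
    ∫⁻ x in Ico (0 : ℝ) 1, ENNReal.ofReal (w ⌊(N : ℝ) / x⌋ / (N + x)) * g (gaussT N x) ≤
      ∫⁻ y in Ico (0 : ℝ) 1, (∑' k : ℕ, ENNReal.ofReal
        (w (N + k : ℕ) / (((N + k : ℕ) + y) * ((N + k : ℕ) + y + 1)))) * g y := by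
  rw [← restrict_Ioo_eq_restrict_Ico]
  calc
    _ ≤ _ := lintegral_mono_set (Ioo_subset_iUnion_gaussT_branch hN)
    _ ≤ _ := lintegral_iUnion_le _ _
    _ = ∑' k : ℕ, ∫⁻ y in Ico (0 : ℝ) 1, ENNReal.ofReal
        (w (N + k : ℕ) / (((N + k : ℕ) + y) * ((N + k : ℕ) + y + 1))) * g y :=
      tsum_congr fun k => lintegral_gaussT_branch hN w g (by omega)
    _ = _ := by
      rw [← lintegral_tsum fun k => by fun_prop, restrict_Ioo_eq_restrict_Ico]
      simp_rw [ENNReal.tsum_mul_right]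

theorem exp_neg_le_one_sub_half {x : ℝ} (h0 : 0 ≤ x) (h1 : x ≤ 1) : Real.exp (-x) ≤ 1 - x / 2 := by
  rw [Real.exp_neg]
  calc
    (Real.exp x)⁻¹ ≤ (x + 1)⁻¹ := by
      gcongr
      exact Real.add_one_le_exp x
    _ ≤ 1 - x / 2 := by
      rw [inv_le_iff_one_le_mul₀ (by positivity)]
      nlinarith

theorem sum_range_inv_mul_succ_le {c : ℝ} (hc : 0 < c) (n : ℕ) :
    ∑ k ∈ Finset.range n, 1 / ((c + k) * (c + k + 1)) ≤ 1 / c := by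
  have h : ∑ k ∈ Finset.range n, 1 / ((c + k) * (c + k + 1)) = 1 / c - 1 / (c + n) := by
    induction n with
    | zero => simp
    | succ n ih =>
      rw [Finset.sum_range_succ, ih]
      push_cast
      field_simp
      ring
  rw [h]
  have : 0 ≤ 1 / (c + n) := by positivity
  linarith

/-- Arbitrarily strong contraction of the exponentially weighted transfer operator of `gaussT`,
relative to the size of the exponent, at the invariant density `1 / (N + y)`. -/
theorem exists_tsum_exp_neg_le {N : ℕ} (hN : 0 < N) (K : ℝ) :
    ∃ t : ℝ, 0 < t ∧ ∀ y ∈ Ico (0 : ℝ) 1,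
      ∑' k : ℕ, ENNReal.ofReal (Real.exp (-(t * (N + k : ℕ))) /
        (((N + k : ℕ) + y) * ((N + k : ℕ) + y + 1))) ≤
      ENNReal.ofReal (Real.exp (-(t * K)) / (N + y)) := by
  have hN1 : (1 : ℝ) ≤ N := by exact_mod_cast hN
  obtain ⟨M, hM⟩ := (Real.tendsto_sum_range_one_div_nat_succ_atTop.eventually_ge_atTop
    (4 * (N + 2) * K)).exists
  refine ⟨1 / (N + M), by positivity, fun y hy => ?_⟩
  set t : ℝ := 1 / (N + M) with ht
  have ht0 : 0 < t := by positivity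
  obtain ⟨hy0, hy1⟩ := hy
  have hc : 0 < (N : ℝ) + y := by linarith
  set b : ℕ → ℝ := fun k => 1 / ((N + y + k) * (N + y + k + 1)) with hb
  have hb0 : ∀ k, 0 ≤ b k := fun k => by positivity
  set f : ℕ → ℝ := fun k => Real.exp (-(t * (N + k))) * b k with hf
  have hf0 : ∀ k, 0 ≤ f k := fun k => by positivity
  have hfb : ∀ k, f k ≤ b k := fun k =>
    mul_le_of_le_one_left (hb0 k) (Real.exp_le_one_iff.2 (neg_nonpos.2 (by positivity)))
  have hfb' : ∀ k < M, f k ≤ b k - t / (4 * (N + 2) * (N + y)) * (1 / (k + 1)) := by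
    intro k hk
    have hk' : (k : ℝ) ≤ M := by exact_mod_cast hk.le
    have htk : t * (N + k) ≤ 1 := by
      rw [ht, one_div_mul_eq_div, div_le_one (by positivity)]
      linarith
    have h1 : f k ≤ (1 - t * (N + k) / 2) * b k :=
      mul_le_mul_of_nonneg_right (exp_neg_le_one_sub_half (by positivity) htk) (hb0 k)
    have h2 : 1 / (2 * (N + 2) * (N + y)) * (1 / (k + 1)) ≤ (N + k) * b k := by
      have hk0 : (0 : ℝ) ≤ k := k.cast_nonneg
      simp only [hb]
      rw [div_mul_div_comm, mul_one_div, div_le_div_iff₀ (by positivity) (by positivity), one_mul,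
        one_mul]
      have e1 : (N : ℝ) + y + k ≤ 2 * (N + k) := by linarith
      have e2 : (N : ℝ) + y + k + 1 ≤ (N + 2) * (N + y) * (k + 1) := by
        have : (N : ℝ) + y + k + 1 ≤ (N + 2) * (k + 1) := by nlinarith
        have h3 : (1 : ℝ) ≤ N + y := by linarith
        have : (N + 2) * ((k : ℝ) + 1) ≤ (N + 2) * (k + 1) * (N + y) :=
          le_mul_of_one_le_right (by positivity) h3
        linarith
      calc
        ((N : ℝ) + y + k) * (N + y + k + 1) ≤ (2 * (N + k)) * ((N + 2) * (N + y) * (k + 1)) := by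
          gcongr
        _ = _ := by ring
    have h3 : t / (4 * (N + 2) * (N + y)) * (1 / (k + 1)) =
        t / 2 * (1 / (2 * (N + 2) * (N + y)) * (1 / (k + 1))) := by
      field_simp
      norm_num
    rw [h3]
    have := mul_le_mul_of_nonneg_left h2 (by positivity : 0 ≤ t / 2)
    linarith
  have hsum : ∀ n, ∑ k ∈ Finset.range n, f k ≤ Real.exp (-(t * K)) / (N + y) := by
    intro n
    calc
      ∑ k ∈ Finset.range n, f k ≤ ∑ k ∈ Finset.range (M + n), f k :=
        Finset.sum_le_sum_of_subset_of_nonneg (Finset.range_subset_range.2 (by omega))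
          fun k _ _ => hf0 k
      _ = ∑ k ∈ Finset.range M, f k + ∑ k ∈ Finset.range n, f (M + k) := Finset.sum_range_add _ _ _
      _ ≤ ∑ k ∈ Finset.range M, (b k - t / (4 * (N + 2) * (N + y)) * (1 / (k + 1))) +
          ∑ k ∈ Finset.range n, b (M + k) := by
        gcongr with k hk k hk
        · exact hfb' k (Finset.mem_range.1 hk)
        · exact hfb _
      _ = ∑ k ∈ Finset.range (M + n), b k -
          t / (4 * (N + 2) * (N + y)) * ∑ k ∈ Finset.range M, (1 / ((k : ℝ) + 1)) := by
        rw [Finset.sum_sub_distrib, Finset.sum_range_add, Finset.mul_sum]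
        ring
      _ ≤ 1 / (N + y) - t / (4 * (N + 2) * (N + y)) * (4 * (N + 2) * K) := by
        gcongr
        exact sum_range_inv_mul_succ_le hc _
      _ = (1 - t * K) / (N + y) := by
        field_simp
      _ ≤ _ := by
        gcongr
        linarith [Real.add_one_le_exp (-(t * K))]
  refine ENNReal.tsum_le_of_sum_range_le fun n => ?_
  rw [← ENNReal.ofReal_sum_of_nonneg fun k _ => by positivity]
  refine ENNReal.ofReal_le_ofReal (le_trans (le_of_eq ?_) (hsum n))
  refine Finset.sum_congr rfl fun k _ => ?_
  simp only [hf, hb]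
  push_cast
  rw [mul_one_div, add_right_comm (N : ℝ) y k]

theorem lintegral_exp_neg_birkhoffSum_le {N : ℕ} (hN : 0 < N) {t K : ℝ}
    (h : ∀ y ∈ Ico (0 : ℝ) 1,
      ∑' k : ℕ, ENNReal.ofReal (Real.exp (-(t * (N + k : ℕ))) /
        (((N + k : ℕ) + y) * ((N + k : ℕ) + y + 1))) ≤
      ENNReal.ofReal (Real.exp (-(t * K)) / (N + y))) (n : ℕ) :
    ∫⁻ x in Ico (0 : ℝ) 1, ENNReal.ofReal (1 / (N + x)) * ENNReal.ofReal
        (Real.exp (-(t * birkhoffSum (gaussT N) (fun x => (⌊(N : ℝ) / x⌋ : ℝ)) n x))) ≤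
      ENNReal.ofReal (Real.exp (-(t * K))) ^ n := by
  have hN1 : (1 : ℝ) ≤ N := by exact_mod_cast hN
  induction n with
  | zero =>
    calc
      _ ≤ ∫⁻ x in Ico (0 : ℝ) 1, 1 := by
        refine setLIntegral_mono measurable_const fun x hx => ?_
        simp only [birkhoffSum_zero, mul_zero, neg_zero, Real.exp_zero, ENNReal.ofReal_one, mul_one,
          ENNReal.ofReal_le_one]
        exact (div_le_one (by linarith [hx.1])).2 (by linarith [hx.1])
      _ = _ := by simp
  | succ n ih =>
    set S := birkhoffSum (gaussT N) (fun x => (⌊(N : ℝ) / x⌋ : ℝ)) with hS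
    have hmeas : Measurable fun x => ENNReal.ofReal (Real.exp (-(t * S n x))) := by
      have := measurable_birkhoffSum_floor N n
      fun_prop
    calc
      _ = ∫⁻ x in Ico (0 : ℝ) 1, ENNReal.ofReal
          ((fun a => Real.exp (-(t * a))) ⌊(N : ℝ) / x⌋ / (N + x)) *
          ENNReal.ofReal (Real.exp (-(t * S n (gaussT N x)))) := by
        refine setLIntegral_congr_fun measurableSet_Ico fun x hx => ?_
        have : 0 ≤ (N : ℝ) + x := by linarith [hx.1]
        simp only [hS, birkhoffSum_succ']
        rw [← ENNReal.ofReal_mul (by positivity), ← ENNReal.ofReal_mul (by positivity), mul_add,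
          neg_add, Real.exp_add]
        congr 1
        ring
      _ ≤ ∫⁻ y in Ico (0 : ℝ) 1, (∑' k : ℕ, ENNReal.ofReal (Real.exp (-(t * (N + k : ℕ))) /
          (((N + k : ℕ) + y) * ((N + k : ℕ) + y + 1)))) *
          ENNReal.ofReal (Real.exp (-(t * S n y))) :=
        lintegral_gaussT_le (w := fun a => Real.exp (-(t * a))) hN hmeas
      _ ≤ ∫⁻ y in Ico (0 : ℝ) 1, ENNReal.ofReal (Real.exp (-(t * K))) *
          (ENNReal.ofReal (1 / (N + y)) * ENNReal.ofReal (Real.exp (-(t * S n y)))) := by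
        refine setLIntegral_mono (by fun_prop) fun y hy => ?_
        rw [← mul_assoc, ← ENNReal.ofReal_mul (by positivity), mul_one_div]
        gcongr
        exact h y hy
      _ = ENNReal.ofReal (Real.exp (-(t * K))) * _ := lintegral_const_mul _ (by fun_prop)
      _ ≤ _ := by
        rw [pow_succ']
        gcongr

theorem ae_eventually_mul_le_birkhoffSum {N : ℕ} (hN : 0 < N) (K : ℝ) :
    ∀ᵐ x ∂(volume.restrict (Ico (0 : ℝ) 1)), ∀ᶠ n : ℕ in atTop,
      n * K ≤ birkhoffSum (gaussT N) (fun x => (⌊(N : ℝ) / x⌋ : ℝ)) n x := by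
  obtain ⟨t, ht, h⟩ := exists_tsum_exp_neg_le hN (K + 1)
  set S := birkhoffSum (gaussT N) (fun x => (⌊(N : ℝ) / x⌋ : ℝ))
  set F : ℕ → ℝ → ENNReal := fun n x => ENNReal.ofReal (Real.exp (t * K)) ^ n *
    (ENNReal.ofReal (1 / (N + x)) * ENNReal.ofReal (Real.exp (-(t * S n x)))) with hF
  have hmeas : ∀ n, Measurable (F n) := fun n => by
    have := measurable_birkhoffSum_floor N n
    fun_prop
  have hint : ∫⁻ x in Ico (0 : ℝ) 1, ∑' n, F n x ≠ ⊤ := by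
    rw [lintegral_tsum fun n => (hmeas n).aemeasurable]
    have hle : ∀ n, ∫⁻ x in Ico (0 : ℝ) 1, F n x ≤ ENNReal.ofReal (Real.exp (-t)) ^ n := by
      intro n
      rw [lintegral_const_mul _ (by have := measurable_birkhoffSum_floor N n; fun_prop)]
      calc
        _ ≤ ENNReal.ofReal (Real.exp (t * K)) ^ n *
            ENNReal.ofReal (Real.exp (-(t * (K + 1)))) ^ n := by
          gcongr
          exact lintegral_exp_neg_birkhoffSum_le hN h n
        _ = _ := by
          rw [← mul_pow, ← ENNReal.ofReal_mul (by positivity), ← Real.exp_add]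
          ring_nf
    refine ne_top_of_le_ne_top ?_ (ENNReal.tsum_le_tsum hle)
    rw [ENNReal.tsum_geometric, ENNReal.inv_ne_top]
    refine (tsub_pos_of_lt ?_).ne'
    rw [ENNReal.ofReal_lt_one, Real.exp_lt_one_iff]
    linarith
  filter_upwards [ae_lt_top (Measurable.tsum hmeas) hint,
    ae_restrict_mem measurableSet_Ico] with x hx hx01
  have hpos : 0 < (N : ℝ) + x := by
    have : (0 : ℝ) < N := by exact_mod_cast hN
    linarith [hx01.1]
  have htend := ENNReal.tendsto_atTop_zero_of_tsum_ne_top hx.ne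
  have hlt : (0 : ENNReal) < ENNReal.ofReal (1 / (N + x)) :=
    ENNReal.ofReal_pos.2 (by positivity)
  filter_upwards [htend.eventually_lt_const hlt] with n hn
  simp only [hF] at hn
  rw [← ENNReal.ofReal_pow (by positivity), ← ENNReal.ofReal_mul (by positivity),
    ← ENNReal.ofReal_mul (by positivity), ENNReal.ofReal_lt_ofReal_iff (by positivity),
    mul_left_comm, ← Real.exp_nat_mul, ← Real.exp_add,
    mul_lt_iff_lt_one_right (by positivity), Real.exp_lt_one_iff] at hn
  have : t * (n * K - S n x) < 0 := by linarith
  nlinarith [neg_of_mul_neg_right this ht.le]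

theorem intCast_le_rpow {r : ℝ} (hr : 1 ≤ r) {a : ℤ} (ha : 0 ≤ a) : (a : ℝ) ≤ (a : ℝ) ^ r := by
  rcases ha.eq_or_lt with rfl | h
  · rw [Int.cast_zero, Real.zero_rpow (by linarith)]
  · exact Real.self_le_rpow_of_one_le (by exact_mod_cast h) hr

/-- For every real `r ≥ 1` and Lebesgue almost every `x ∈ [0,1)`, the `r`-Hölder mean
of the `N`-continued fraction coefficients `a_k = ⌊N / T_N^[k-1] x⌋` of `x` diverges:
`((1/n) ∑_{j=1}^n a_j^r)^(1/r) → +∞`, equivalently `(1/n) ∑_{j=1}^n a_j^r → +∞`. -/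
theorem gaussT_coeff_holder_mean_infinite (N : ℕ) (hN : 0 < N) (r : ℝ) (hr : 1 ≤ r) :
    ∀ᵐ x ∂(volume.restrict (Set.Ico (0:ℝ) 1)),
      Tendsto (fun n : ℕ =>
          ((1 / (n : ℝ)) *
            ∑ j ∈ Finset.range n, (⌊(N : ℝ) / (gaussT N)^[j] x⌋ : ℝ) ^ r) ^ (1 / r))
        atTop atTop ∧
      Tendsto (fun n : ℕ =>
          (1 / (n : ℝ)) *
            ∑ j ∈ Finset.range n, (⌊(N : ℝ) / (gaussT N)^[j] x⌋ : ℝ) ^ r)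
        atTop atTop := by
  filter_upwards [ae_all_iff.2 fun K : ℕ => ae_eventually_mul_le_birkhoffSum hN (K : ℝ),
    ae_restrict_mem measurableSet_Ico] with x hx hx01
  have key : Tendsto (fun n : ℕ => (1 / (n : ℝ)) *
      ∑ j ∈ Finset.range n, (⌊(N : ℝ) / (gaussT N)^[j] x⌋ : ℝ) ^ r) atTop atTop := by
    refine tendsto_atTop.2 fun B => ?_
    obtain ⟨K, hK⟩ := exists_nat_ge B
    filter_upwards [hx K, eventually_gt_atTop 0] with n hn hn0
    have hn0' : (0 : ℝ) < n := by exact_mod_cast hn0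
    rw [one_div_mul_eq_div, le_div_iff₀ hn0']
    calc
      B * n ≤ n * K := by nlinarith
      _ ≤ _ := hn
      _ ≤ _ := Finset.sum_le_sum fun j _ => intCast_le_rpow hr
        (Int.floor_nonneg.2 (div_nonneg N.cast_nonneg (iterate_gaussT_nonneg N hx01.1 j)))
  exact ⟨(tendsto_rpow_atTop (by positivity)).comp key, key⟩
end

section
/- For every positive integer N and every real r < 1 with r ≠ 0, for Lebesgue almost every x ∈ [0,1) with N-continued fraction coefficients (a_k), the r-Hölder mean converges: lim_{n→∞} ((1/n) Σ_{j=1}^n a_j^r)^{1/r} = K_{N,r} := (Σ_{k=N}^∞ k^r · (ln(1+1/k) − ln(1+1/(k+1)))/ln(1+1/N))^{1/r}. -/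
open MeasureTheory Filter Set

/-- The constant `K_{N,r} = (∑_{k=N}^∞ k^r (log(1+1/k) - log(1+1/(k+1))) / log(1+1/N))^(1/r)`
(the sum is reindexed by `k = j + N`, `j : ℕ`). -/
noncomputable def holderConst (N : ℕ) (r : ℝ) : ℝ :=
  (∑' j : ℕ,
      ((j : ℝ) + N) ^ r *
        ((Real.log (1 + 1 / ((j : ℝ) + N)) - Real.log (1 + 1 / ((j : ℝ) + N + 1))) /
          Real.log (1 + 1 / (N : ℝ)))) ^ (1 / r)

section Birkhoff

variable {α : Type*}

/-- The running maximum of the Birkhoff sums of `f` of orders `1, …, n + 1`. -/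
noncomputable def birkhoffMax (T : α → α) (f : α → ℝ) : ℕ → α → ℝ
  | 0, x => f x
  | n + 1, x => f x + max 0 (birkhoffMax T f n (T x))

theorem birkhoffSum_succ_le_birkhoffMax (T : α → α) (f : α → ℝ) (n : ℕ) (x : α) :
    birkhoffSum T f (n + 1) x ≤ birkhoffMax T f n x := by
  induction n generalizing x with
  | zero => simp [birkhoffMax]
  | succ n ih =>
    rw [birkhoffSum_succ', birkhoffMax]
    gcongr
    exact (ih _).trans (le_max_right _ _)

theorem birkhoffMax_monotone (T : α → α) (f : α → ℝ) (x : α) :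
    Monotone fun n => birkhoffMax T f n x := by
  refine monotone_nat_of_le_succ fun n => ?_
  induction n generalizing x with
  | zero => simp [birkhoffMax]
  | succ n ih =>
    rw [birkhoffMax, birkhoffMax]
    gcongr
    exact ih _

theorem bddAbove_birkhoffMax_comp_iff (T : α → α) (f : α → ℝ) (x : α) :
    BddAbove (range fun n => birkhoffMax T f n (T x)) ↔
      BddAbove (range fun n => birkhoffMax T f n x) := by
  constructor
  · rintro ⟨M, hM⟩
    refine ⟨f x + max 0 M, ?_⟩
    rintro _ ⟨n, rfl⟩
    refine (birkhoffMax_monotone T f x n.le_succ).trans ?_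
    change f x + max 0 _ ≤ _
    gcongr
    exact hM ⟨n, rfl⟩
  · rintro ⟨M, hM⟩
    refine ⟨M - f x, ?_⟩
    rintro _ ⟨n, rfl⟩
    have h : f x + max 0 (birkhoffMax T f n (T x)) ≤ M := hM ⟨n + 1, rfl⟩
    have := le_max_right 0 (birkhoffMax T f n (T x))
    change birkhoffMax T f n (T x) ≤ _
    linarith

variable [MeasurableSpace α] {μ : Measure α} {T : α → α} {f : α → ℝ}

theorem measurable_birkhoffMax (hT : Measurable T) (hf : Measurable f) (n : ℕ) :
    Measurable (birkhoffMax T f n) := by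
  induction n with
  | zero => exact hf
  | succ n ih => exact hf.add (measurable_const.max (ih.comp hT))

theorem integrable_birkhoffMax (hT : MeasurePreserving T μ μ) (hf : Integrable f μ) (n : ℕ) :
    Integrable (birkhoffMax T f n) μ := by
  induction n with
  | zero => exact hf
  | succ n ih =>
    refine hf.add ?_
    have h := (hT.integrable_comp_of_integrable ih).pos_part
    simpa only [Function.comp_apply, max_comm] using h

theorem Ergodic.ae_bddAbove_birkhoffMax (hT : Ergodic T μ) (hfm : Measurable f)
    (hf : Integrable f μ) (hneg : ∫ x, f x ∂μ < 0) :
    ∀ᵐ x ∂μ, BddAbove (range fun n => birkhoffMax T f n x) := by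
  have hmp := hT.toMeasurePreserving
  have hms : MeasurableSet {x | BddAbove (range fun n => birkhoffMax T f n x)} :=
    measurableSet_bddAbove_range fun n => measurable_birkhoffMax hmp.measurable hfm n
  have hinv : T ⁻¹' {x | BddAbove (range fun n => birkhoffMax T f n x)} =
      {x | BddAbove (range fun n => birkhoffMax T f n x)} :=
    Set.ext fun x => bddAbove_birkhoffMax_comp_iff T f x
  rcases hT.toPreErgodic.ae_mem_or_ae_notMem hms hinv with h | h
  · exact h
  exfalso
  have hcomp (n : ℕ) : Integrable (fun x => birkhoffMax T f n (T x)) μ :=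
    hmp.integrable_comp_of_integrable (integrable_birkhoffMax hmp hf n)
  have hlim : Tendsto (fun n => ∫ x, (birkhoffMax T f (n + 1) x - birkhoffMax T f n (T x)) ∂μ)
      atTop (nhds (∫ x, f x ∂μ)) := by
    refine tendsto_integral_of_dominated_convergence (fun x => |f x| + |f (T x)|) (fun n => ?_)
      (hf.abs.add (hmp.integrable_comp_of_integrable hf).abs) (fun n => ?_) ?_
    · exact ((integrable_birkhoffMax hmp hf (n + 1)).sub (hcomp n)).aestronglyMeasurable
    · refine Eventually.of_forall fun x => ?_
      have h0 : f (T x) ≤ birkhoffMax T f n (T x) :=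
        birkhoffMax_monotone T f (T x) (Nat.zero_le n)
      rw [birkhoffMax, Real.norm_eq_abs]
      have := neg_abs_le (f (T x))
      have := abs_nonneg (f (T x))
      have := neg_abs_le (f x)
      have := le_abs_self (f x)
      rcases max_cases 0 (birkhoffMax T f n (T x)) with h | h <;> rw [abs_le] <;>
        constructor <;> linarith
    · filter_upwards [h] with x hx
      have hx' : ¬ BddAbove (range fun n => birkhoffMax T f n (T x)) :=
        fun hb => hx ((bddAbove_birkhoffMax_comp_iff T f x).1 hb)
      have htop := tendsto_atTop_of_monotone (birkhoffMax_monotone T f (T x))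
      rcases htop with htop | ⟨l, hl⟩
      · refine tendsto_const_nhds.congr' ?_
        filter_upwards [htop.eventually_ge_atTop 0] with n hn
        rw [birkhoffMax, max_eq_right hn]
        ring
      · exact absurd hl.bddAbove_range hx'
  refine hneg.not_ge (ge_of_tendsto' hlim fun n => ?_)
  have hintegral : ∫ x, birkhoffMax T f n (T x) ∂μ = ∫ x, birkhoffMax T f n x ∂μ := by
    rw [← integral_map (φ := T) hmp.measurable.aemeasurable
      (measurable_birkhoffMax hmp.measurable hfm n).aestronglyMeasurable, hmp.map_eq]
  rw [integral_sub (integrable_birkhoffMax hmp hf _) (hcomp n), hintegral, sub_nonneg]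
  exact integral_mono (integrable_birkhoffMax hmp hf _) (integrable_birkhoffMax hmp hf _)
    fun x => birkhoffMax_monotone T f x n.le_succ

theorem Ergodic.ae_eventually_birkhoffSum_le [IsProbabilityMeasure μ] (hT : Ergodic T μ)
    (hfm : Measurable f) (hf : Integrable f μ) {c : ℝ} (hc : ∫ x, f x ∂μ < c) :
    ∀ᵐ x ∂μ, ∀ᶠ n : ℕ in atTop, birkhoffSum T f n x ≤ n * c := by
  obtain ⟨d, hd, hdc⟩ := exists_between hc
  have hintegral : ∫ x, (f x - d) ∂μ < 0 := by
    rw [integral_sub hf (integrable_const _)]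
    simpa using hd
  filter_upwards [hT.ae_bddAbove_birkhoffMax (hfm.sub_const d) (hf.sub (integrable_const d))
    hintegral]
    with x ⟨M, hM⟩
  obtain ⟨n₀, hn₀⟩ := exists_nat_gt (M / (c - d))
  filter_upwards [eventually_ge_atTop (max n₀ 1)] with n hn
  obtain ⟨m, rfl⟩ := Nat.exists_eq_succ_of_ne_zero (n := n) (by lia)
  have h1 := (birkhoffSum_succ_le_birkhoffMax T (fun y => f y - d) m x).trans (hM ⟨m, rfl⟩)
  have h2 : birkhoffSum T (fun y => f y - d) (m + 1) x =
      birkhoffSum T f (m + 1) x - (m + 1 : ℕ) * d := by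
    simp [birkhoffSum]
  have h3 : (n₀ : ℝ) ≤ (m + 1 : ℕ) := by exact_mod_cast (le_max_left _ _).trans hn
  have h4 := (div_lt_iff₀ (sub_pos.2 hdc)).1 (hn₀.trans_le h3)
  rw [h2] at h1
  change _ ≤ ((m + 1 : ℕ) : ℝ) * c
  linarith

/-- The pointwise ergodic theorem for ergodic maps of a probability space. -/
theorem Ergodic.ae_tendsto_birkhoffSum_div [IsProbabilityMeasure μ] (hT : Ergodic T μ)
    (hfm : Measurable f) (hf : Integrable f μ) :
    ∀ᵐ x ∂μ, Tendsto (fun n : ℕ => birkhoffSum T f n x / n) atTop (nhds (∫ x, f x ∂μ)) := by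
  have hup : ∀ᵐ x ∂μ, ∀ k : ℕ, ∀ᶠ n : ℕ in atTop,
      birkhoffSum T f n x ≤ n * (∫ x, f x ∂μ + 1 / ((k : ℝ) + 1)) :=
    ae_all_iff.2 fun k => hT.ae_eventually_birkhoffSum_le hfm hf
      (lt_add_of_pos_right _ Nat.one_div_pos_of_nat)
  have hlow : ∀ᵐ x ∂μ, ∀ k : ℕ, ∀ᶠ n : ℕ in atTop,
      birkhoffSum T (fun y => -f y) n x ≤ n * (∫ x, -f x ∂μ + 1 / ((k : ℝ) + 1)) :=
    ae_all_iff.2 fun k => hT.ae_eventually_birkhoffSum_le hfm.neg hf.neg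
      (lt_add_of_pos_right _ Nat.one_div_pos_of_nat)
  filter_upwards [hup, hlow] with x h1 h2
  rw [Metric.tendsto_nhds]
  intro ε hε
  obtain ⟨k, hk⟩ := exists_nat_one_div_lt hε
  filter_upwards [h1 k, h2 k, eventually_gt_atTop 0] with n hn1 hn2 hn
  have hn' : (0 : ℝ) < n := by exact_mod_cast hn
  have hneg : birkhoffSum T (fun y => -f y) n x = -birkhoffSum T f n x := by
    simp [birkhoffSum]
  rw [hneg, integral_neg] at hn2
  rw [Real.dist_eq]
  refine lt_of_le_of_lt ?_ hk
  have h5 : birkhoffSum T f n x / n ≤ ∫ x, f x ∂μ + 1 / ((k : ℝ) + 1) := by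
    rw [div_le_iff₀ hn']; linarith
  have h6 : ∫ x, f x ∂μ - 1 / ((k : ℝ) + 1) ≤ birkhoffSum T f n x / n := by
    rw [le_div_iff₀ hn']; linarith
  rw [abs_le]
  constructor <;> linarith

end Birkhoff

theorem gaussT_div_add {N k : ℕ} (hN : 0 < N) (hk : 0 < k) {y : ℝ} (hy : y ∈ Ico (0 : ℝ) 1) :
    gaussT N (N / (k + y)) = y := by
  have hN' : (0 : ℝ) < N := by exact_mod_cast hN
  have hk' : (0 : ℝ) < k := by exact_mod_cast hk
  have hky : (0 : ℝ) < k + y := by linarith [hy.1]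
  rw [gaussT, if_neg (div_pos hN' hky).ne', div_div_cancel₀ hN'.ne', Int.fract_natCast_add,
    Int.fract_eq_self.2 hy]

theorem Irrational.gaussT_mem {N : ℕ} (hN : 0 < N) {x : ℝ} (hx : Irrational x) :
    Irrational (gaussT N x) ∧ gaussT N x ∈ Ioo (0 : ℝ) 1 := by
  have h : Irrational (gaussT N x) := by
    rw [gaussT, if_neg hx.ne_zero, Int.fract]
    exact (hx.natCast_div hN.ne').sub_intCast _
  refine ⟨h, lt_of_le_of_ne ?_ h.ne_zero.symm, ?_⟩ <;> rw [gaussT, if_neg hx.ne_zero]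
  · exact Int.fract_nonneg _
  · exact Int.fract_lt_one _

theorem Irrational.gaussT_iterate_mem {N : ℕ} (hN : 0 < N) {x : ℝ} (hx : Irrational x)
    (hx01 : x ∈ Ioo (0 : ℝ) 1) (n : ℕ) :
    Irrational ((gaussT N)^[n] x) ∧ (gaussT N)^[n] x ∈ Ioo (0 : ℝ) 1 := by
  induction n with
  | zero => exact ⟨hx, hx01⟩
  | succ n ih =>
    rw [Function.iterate_succ_apply']
    exact ih.1.gaussT_mem hN

theorem exists_eq_div_natCast_add_gaussT {N : ℕ} (hN : 0 < N) {x : ℝ} (hx : x ∈ Ioo (0 : ℝ) 1) :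
    ∃ k : ℕ, N ≤ k ∧ x = N / (k + gaussT N x) := by
  have hN' : (0 : ℝ) < N := by exact_mod_cast hN
  refine ⟨⌊(N : ℝ) / x⌋₊, Nat.le_floor ?_, ?_⟩
  · rw [le_div_iff₀ hx.1]
    nlinarith [hx.2]
  · rw [gaussT, if_neg hx.1.ne', natCast_floor_eq_intCast_floor (div_pos hN' hx.1).le,
      Int.floor_add_fract, div_div_cancel₀ hN'.ne']

/-- The inverse branch of an iterate of the generalized Gauss transformation around an irrational
point is a Möbius map with nonnegative, ordered denominator coefficients. -/
theorem exists_moebius_inverse_branch {N : ℕ} (hN : 0 < N) {x : ℝ} (hx : Irrational x)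
    (hx01 : x ∈ Ioo (0 : ℝ) 1) (n : ℕ) :
    ∃ p p' q q' : ℝ, 0 < q ∧ 0 ≤ q' ∧ q' ≤ q ∧ p' * q - p * q' ≠ 0 ∧
      |p' * q - p * q'| * 2 ^ n ≤ q * (q + q') ∧
      x = (p + p' * (gaussT N)^[n] x) / (q + q' * (gaussT N)^[n] x) ∧
      ∀ y ∈ Ioo (0 : ℝ) 1, (gaussT N)^[n] ((p + p' * y) / (q + q' * y)) = y := by
  have hN' : (1 : ℝ) ≤ N := by exact_mod_cast hN
  induction n with
  | zero => exact ⟨0, 1, 1, 0, by simp⟩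
  | succ n ih =>
    obtain ⟨p, p', q, q', hq, hq', hqq, hD, hDn, hxeq, hinv⟩ := ih
    obtain ⟨k, hNk, hk⟩ := exists_eq_div_natCast_add_gaussT hN
      (hx.gaussT_iterate_mem hN hx01 n).2
    have hNk' : (N : ℝ) ≤ k := by exact_mod_cast hNk
    have hmoeb {y : ℝ} (hy : 0 < y) : (p + p' * (N / (k + y))) / (q + q' * (N / (k + y))) =
        ((p * k + p' * N) + p * y) / ((q * k + q' * N) + q * y) := by
      have h1 : (0 : ℝ) < k + y := by linarith
      rw [show p + p' * (N / (k + y)) = ((p * k + p' * N) + p * y) / (k + y) by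
          field_simp; ring,
        show q + q' * (N / (k + y)) = ((q * k + q' * N) + q * y) / (k + y) by
          field_simp; ring, div_div_div_cancel_right₀ h1.ne']
    have hq1 : N * (q + q') ≤ q * k + q' * N := by nlinarith
    have hq2 : q ≤ q * k + q' * N := by nlinarith
    have hdet : p * (q * k + q' * N) - (p * k + p' * N) * q = -(N * (p' * q - p * q')) := by ring
    refine ⟨p * k + p' * N, p, q * k + q' * N, q, by linarith, hq.le, hq2, ?_, ?_, ?_, ?_⟩
    · rw [hdet]
      exact neg_ne_zero.2 (mul_ne_zero (by linarith) hD)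
    · rw [hdet, abs_neg, abs_mul, Nat.abs_cast, pow_succ]
      calc N * |p' * q - p * q'| * (2 ^ n * 2) = 2 * N * (|p' * q - p * q'| * 2 ^ n) := by ring
        _ ≤ 2 * N * (q * (q + q')) := by gcongr
        _ = (N * (q + q')) * (2 * q) := by ring
        _ ≤ (q * k + q' * N) * (q * k + q' * N + q) := by
          apply mul_le_mul hq1 <;> nlinarith
    · rw [Function.iterate_succ_apply', ← hmoeb, ← hk, ← hxeq]
      exact ((hx.gaussT_iterate_mem hN hx01 n).1.gaussT_mem hN).2.1
    · intro y hy
      have hky : (0 : ℝ) < k + y := by linarith [hy.1]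
      rw [← hmoeb hy.1, Function.iterate_succ_apply', hinv,
        gaussT_div_add hN (hN.trans_le hNk) ⟨hy.1.le, hy.2⟩]
      refine ⟨div_pos (by linarith) hky, ?_⟩
      rw [div_lt_one hky]
      linarith [hy.1]

theorem exists_inverse_branch {N : ℕ} (hN : 0 < N) {x : ℝ} (hx : Irrational x)
    (hx01 : x ∈ Ioo (0 : ℝ) 1) (n : ℕ) :
    ∃ (w δ : ℝ) (φ : ℝ → ℝ), 0 < δ ∧ δ ≤ (1 / 2) ^ n ∧ x ∈ Metric.closedBall w δ ∧
      (∀ y ∈ Ioo (0 : ℝ) 1, φ y ∈ Metric.closedBall w δ ∧ (gaussT N)^[n] (φ y) = y) ∧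
      ∀ y ∈ Ioo (0 : ℝ) 1, ∀ z ∈ Ioo (0 : ℝ) 1, δ * |y - z| ≤ |φ y - φ z| := by
  obtain ⟨p, p', q, q', hq, hq', hqq, hD, hDn, hxeq, hinv⟩ :=
    exists_moebius_inverse_branch hN hx hx01 n
  set D := p' * q - p * q' with hDdef
  have hD0 : 0 < |D| := abs_pos.2 hD
  have hden {y : ℝ} (hy : y ∈ Ioo (0 : ℝ) 1) : 0 < q + q' * y := by nlinarith [hy.1]
  have hball : ∀ y ∈ Ioo (0 : ℝ) 1, (p + p' * y) / (q + q' * y) ∈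
      Metric.closedBall (p / q + D / (2 * q * (q + q'))) (|D| / (2 * q * (q + q'))) := by
    intro y hy
    have hy' := hden hy
    rw [mem_closedBall_iff_norm, Real.norm_eq_abs]
    have h1 : (p + p' * y) / (q + q' * y) - (p / q + D / (2 * q * (q + q'))) =
        D / (2 * q * (q + q')) * ((2 * y * (q + q') - (q + q' * y)) / (q + q' * y)) := by
      have hq2 : 2 * q * (q + q') ≠ 0 := by positivity
      rw [hDdef, div_add_div _ _ hq.ne' hq2, div_sub_div _ _ hy'.ne' (mul_ne_zero hq.ne' hq2),
        div_mul_div_comm, div_eq_div_iff (mul_ne_zero hy'.ne' (mul_ne_zero hq.ne' hq2))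
          (mul_ne_zero hq2 hy'.ne')]
      ring
    rw [h1, abs_mul, abs_div D, abs_of_pos (show 0 < 2 * q * (q + q') by positivity)]
    refine mul_le_of_le_one_right (by positivity) ?_
    rw [abs_div, abs_of_pos hy', div_le_one hy', abs_le]
    constructor <;> nlinarith [hy.1, hy.2, mul_nonneg hq' hy.1.le, mul_pos hq hy.1]
  refine ⟨_, |D| / (2 * q * (q + q')), fun y => (p + p' * y) / (q + q' * y), by positivity,
    ?_, ?_, fun y hy => ⟨hball y hy, hinv y hy⟩, ?_⟩
  · rw [div_le_iff₀ (by positivity), one_div, inv_pow, ← div_eq_inv_mul,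
      le_div_iff₀ (by positivity)]
    nlinarith [mul_pos hq hq, mul_nonneg hq.le hq']
  · rw [hxeq]
    exact hball _ (hx.gaussT_iterate_mem hN hx01 n).2
  · intro y hy z hz
    have hy' := hden hy
    have hz' := hden hz
    have h1 : (p + p' * y) / (q + q' * y) - (p + p' * z) / (q + q' * z) =
        D / ((q + q' * y) * (q + q' * z)) * (y - z) := by
      rw [hDdef, div_sub_div _ _ hy'.ne' hz'.ne', div_mul_eq_mul_div]
      ring
    have hyq : q + q' * y ≤ 2 * q := by nlinarith [hy.1, hy.2]
    have hzq : q + q' * z ≤ q + q' := by nlinarith [hz.1, hz.2]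
    rw [h1, abs_mul, abs_div, abs_of_pos (mul_pos hy' hz')]
    gcongr

theorem volume_inter_le_of_inverse_branch {N n : ℕ} {w δ : ℝ} {φ : ℝ → ℝ} (hδ : 0 < δ)
    (hφ : ∀ y ∈ Ioo (0 : ℝ) 1, φ y ∈ Metric.closedBall w δ ∧ (gaussT N)^[n] (φ y) = y)
    (hexp : ∀ y ∈ Ioo (0 : ℝ) 1, ∀ z ∈ Ioo (0 : ℝ) 1, δ * |y - z| ≤ |φ y - φ z|)
    {s : Set ℝ} (hs : gaussT N ⁻¹' s = s) :
    ENNReal.ofReal δ * volume (s ∩ Ioo 0 1) ≤ volume (s ∩ Metric.closedBall w δ) := by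
  have hsn : (gaussT N)^[n] ⁻¹' s = s :=
    Function.IsFixedPt.preimage_iterate hs n
  have hlip : LipschitzOnWith (Real.toNNReal δ⁻¹) (gaussT N)^[n] (φ '' (s ∩ Ioo 0 1)) := by
    refine LipschitzOnWith.of_dist_le_mul ?_
    rintro _ ⟨y, hy, rfl⟩ _ ⟨z, hz, rfl⟩
    rw [(hφ y hy.2).2, (hφ z hz.2).2, Real.dist_eq, Real.dist_eq,
      Real.coe_toNNReal _ (inv_nonneg.2 hδ.le), inv_mul_eq_div, le_div_iff₀' hδ]
    exact hexp y hy.2 z hz.2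
  have himg : (gaussT N)^[n] '' (φ '' (s ∩ Ioo 0 1)) = s ∩ Ioo 0 1 := by
    rw [image_image]
    exact (image_congr fun y hy => (hφ y hy.2).2).trans (image_id' _)
  have hsub : φ '' (s ∩ Ioo 0 1) ⊆ s ∩ Metric.closedBall w δ := by
    rintro _ ⟨y, hy, rfl⟩
    refine ⟨?_, (hφ y hy.2).1⟩
    rw [← hsn, mem_preimage, (hφ y hy.2).2]
    exact hy.1
  have h := hlip.hausdorffMeasure_image_le zero_le_one
  rw [himg, hausdorffMeasure_real, ENNReal.rpow_one] at h
  calc ENNReal.ofReal δ * volume (s ∩ Ioo 0 1)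
      ≤ ENNReal.ofReal δ * (ENNReal.ofReal δ⁻¹ * volume (φ '' (s ∩ Ioo 0 1))) := by
        gcongr
        exact h
    _ = volume (φ '' (s ∩ Ioo 0 1)) := by
      rw [← mul_assoc, ← ENNReal.ofReal_mul hδ.le, mul_inv_cancel₀ hδ.ne', ENNReal.ofReal_one,
        one_mul]
    _ ≤ _ := measure_mono hsub

theorem ae_irrational : ∀ᵐ x : ℝ, Irrational x := by
  have h : (range ((↑) : ℚ → ℝ)).Countable := countable_range _
  exact h.ae_notMem volume

/-- A set invariant under the generalized Gauss transformation is Lebesgue-null or conull in the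
unit interval. -/
theorem volume_inter_eq_zero_or_compl_of_gaussT_invariant {N : ℕ} (hN : 0 < N) {s : Set ℝ}
    (hsm : MeasurableSet s) (hs : gaussT N ⁻¹' s = s) :
    volume (s ∩ Ioo 0 1) = 0 ∨ volume (sᶜ ∩ Ioo 0 1) = 0 := by
  by_contra! hcon
  have hae := ae_restrict_of_ae_restrict_of_subset (inter_subset_left (s := s) (t := Ioo 0 1))
    (IsUnifLocDoublingMeasure.ae_tendsto_measure_inter_div (volume : Measure ℝ) s 1)
  have hne : (ae (volume.restrict (s ∩ Ioo (0 : ℝ) 1))).NeBot := by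
    rw [ae_neBot, Ne, Measure.restrict_eq_zero]
    exact hcon.1
  obtain ⟨x, hx, hirr, hxmem⟩ := (hae.and ((ae_restrict_of_ae ae_irrational).and
    (ae_restrict_mem (hsm.inter measurableSet_Ioo)))).exists
  choose w δ φ hδ hδn hxw hφ hexp using exists_inverse_branch hN hirr hxmem.2
  have hδ0 : Tendsto δ atTop (nhdsWithin 0 (Ioi 0)) := by
    refine tendsto_nhdsWithin_iff.2 ⟨?_, Eventually.of_forall hδ⟩
    exact squeeze_zero (fun n => (hδ n).le) hδn
      (tendsto_pow_atTop_nhds_zero_of_lt_one (by norm_num) (by norm_num))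
  have hlim := hx w δ hδ0 (Eventually.of_forall fun n => by simpa using hxw n)
  have hle : 1 + volume (sᶜ ∩ Ioo 0 1) / 2 ≤ 1 := by
    refine le_of_tendsto' (hlim.add_const _) fun n => ?_
    have hc := volume_inter_le_of_inverse_branch (hδ n) (hφ n) (hexp n) (s := sᶜ)
      (by rw [preimage_compl, hs])
    have hδ' : ENNReal.ofReal (δ n) ≠ 0 := by simpa using hδ n
    have hvol : volume (Metric.closedBall (w n) (δ n)) = 2 * ENNReal.ofReal (δ n) := by
      rw [Real.volume_closedBall, ENNReal.ofReal_mul (by norm_num), ENNReal.ofReal_ofNat]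
    have hsplit := measure_inter_add_sdiff (μ := volume) (Metric.closedBall (w n) (δ n)) hsm
    have hhalf : volume (sᶜ ∩ Ioo 0 1) / 2 =
        (ENNReal.ofReal (δ n) * volume (sᶜ ∩ Ioo 0 1)) /
          volume (Metric.closedBall (w n) (δ n)) := by
      rw [hvol, mul_comm 2, ENNReal.mul_div_mul_left _ _ hδ' ENNReal.ofReal_ne_top]
    rw [hhalf, ← ENNReal.add_div]
    refine ENNReal.div_le_of_le_mul ?_
    rw [one_mul, ← hsplit, inter_comm s, sdiff_eq, inter_comm _ sᶜ]
    gcongr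
  have hpos : volume (sᶜ ∩ Ioo (0 : ℝ) 1) / 2 = 0 := by
    by_contra h
    exact (ENNReal.lt_add_right ENNReal.one_ne_top h).not_ge hle
  rw [ENNReal.div_eq_zero_iff] at hpos
  exact hpos.elim hcon.2 (by simp)

theorem floor_div_eq_of_mem_Ioc {N k : ℕ} (hN : 0 < N) (hk : 0 < k) {x : ℝ}
    (hx : x ∈ Ioc ((N : ℝ) / (k + 1)) (N / k)) : ⌊(N : ℝ) / x⌋ = k := by
  have hk' : (0 : ℝ) < k := by exact_mod_cast hk
  have hx0 : 0 < x := lt_trans (by positivity) hx.1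
  rw [Int.floor_eq_iff, Int.cast_natCast]
  exact ⟨(le_div_comm₀ hx0 hk').1 hx.2, (div_lt_comm₀ (by positivity) hx0).1 hx.1⟩

theorem iUnion_Ioc_natCast_div {N : ℕ} (hN : 0 < N) :
    ⋃ j : ℕ, Ioc ((N : ℝ) / ((j + N : ℕ) + 1)) (N / (j + N : ℕ)) = Ioc 0 1 := by
  have hN' : (0 : ℝ) < N := by exact_mod_cast hN
  refine Subset.antisymm (iUnion_subset fun j x hx => ⟨lt_trans (by positivity) hx.1, ?_⟩) ?_
  · refine hx.2.trans ?_
    rw [div_le_one (by positivity)]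
    simp
  · intro x hx
    have hle : N ≤ ⌊(N : ℝ) / x⌋₊ := by
      refine Nat.le_floor ?_
      rw [le_div_iff₀ hx.1]
      nlinarith [hx.2]
    have hpos : (0 : ℝ) < ⌊(N : ℝ) / x⌋₊ := by exact_mod_cast hN.trans_le hle
    refine mem_iUnion.2 ⟨⌊(N : ℝ) / x⌋₊ - N, ?_⟩
    rw [Nat.sub_add_cancel hle]
    exact ⟨(div_lt_comm₀ hx.1 (by positivity)).1 (Nat.lt_floor_add_one _),
      (le_div_comm₀ hpos hx.1).1 (Nat.floor_le (div_pos hN' hx.1).le)⟩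

theorem pairwise_disjoint_Ioc_natCast_div {N : ℕ} (hN : 0 < N) :
    Pairwise (Function.onFun Disjoint
      fun j : ℕ => Ioc ((N : ℝ) / ((j + N : ℕ) + 1)) (N / (j + N : ℕ))) := by
  intro i j hij
  refine disjoint_left.2 fun x hi hj => hij ?_
  have h := (floor_div_eq_of_mem_Ioc hN (by lia) hi).symm.trans
    (floor_div_eq_of_mem_Ioc hN (by lia) hj)
  lia

theorem image_div_natCast_add {N k : ℕ} (hN : 0 < N) (hk : 0 < k) :
    (fun y : ℝ => (N : ℝ) / (k + y)) '' Ico 0 1 = Ioc ((N : ℝ) / (k + 1)) (N / k) := by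
  have hN' : (0 : ℝ) < N := by exact_mod_cast hN
  have hk' : (0 : ℝ) < k := by exact_mod_cast hk
  refine Subset.antisymm ?_ fun x hx => ?_
  · rintro _ ⟨y, hy, rfl⟩
    refine ⟨div_lt_div_of_pos_left hN' (by linarith [hy.1]) (by linarith [hy.2]),
      div_le_div_of_nonneg_left hN'.le hk' (by linarith [hy.1])⟩
  · have hx0 : 0 < x := lt_trans (by positivity) hx.1
    refine ⟨N / x - k, ⟨sub_nonneg.2 ((le_div_comm₀ hx0 hk').1 hx.2), ?_⟩, ?_⟩
    · linarith [(div_lt_comm₀ (by positivity) hx0).1 hx.1]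
    · simp only [add_sub_cancel]
      exact div_div_cancel₀ hN'.ne'

theorem lintegral_Ioc_natCast_div {N k : ℕ} (hN : 0 < N) (hk : 0 < k) (g : ℝ → ENNReal) :
    ∫⁻ x in Ioc ((N : ℝ) / (k + 1)) (N / k), g x =
      ∫⁻ y in Ico 0 1, ENNReal.ofReal (N / (k + y) ^ 2) * g (N / (k + y)) := by
  have hk' : (0 : ℝ) < k := by exact_mod_cast hk
  rw [← image_div_natCast_add hN hk, lintegral_image_eq_lintegral_abs_deriv_mul measurableSet_Ico
    (f' := fun y => -(N / (k + y) ^ 2))]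
  · refine setLIntegral_congr_fun measurableSet_Ico fun y hy => ?_
    rw [abs_neg, abs_of_nonneg (by positivity)]
  · intro y hy
    have h := (((hasDerivAt_id y).const_add (k : ℝ)).fun_inv
      (by simp only [id]; linarith [hy.1])).const_mul (N : ℝ)
    refine (h.congr_deriv ?_).hasDerivWithinAt.congr (fun z _ => ?_) ?_ <;>
      simp [div_eq_mul_inv]
  · intro y hy z hz h
    have := congrArg (gaussT N) h
    simpa only [gaussT_div_add hN hk hy, gaussT_div_add hN hk hz] using this

/-- The density of the invariant probability measure of the generalized Gauss transformation. -/
noncomputable def gaussDensity (N : ℕ) (x : ℝ) : ℝ :=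
  1 / (Real.log (1 + 1 / (N : ℝ)) * (N + x))

/-- The invariant probability measure of the generalized Gauss transformation. -/
noncomputable def gaussMeasure (N : ℕ) : Measure ℝ :=
  (volume.restrict (Ioc 0 1)).withDensity fun x => ENNReal.ofReal (gaussDensity N x)

theorem log_one_add_one_div_natCast_pos {N : ℕ} (hN : 0 < N) :
    0 < Real.log (1 + 1 / (N : ℝ)) :=
  Real.log_pos (by simpa using hN)

theorem measurable_gaussDensity (N : ℕ) : Measurable (gaussDensity N) :=
  measurable_const.div (measurable_const.mul (measurable_const.add measurable_id))

theorem gaussDensity_pos {N : ℕ} (hN : 0 < N) {x : ℝ} (hx : 0 ≤ x) : 0 < gaussDensity N x := by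
  have := log_one_add_one_div_natCast_pos hN
  rw [gaussDensity]
  positivity

theorem hasSum_one_div_mul_add_one {L a : ℝ} (hL : 0 < L) (ha : 0 < a) :
    HasSum (fun j : ℕ => 1 / (L * ((j + a) * (j + a + 1)))) (1 / (L * a)) := by
  rw [hasSum_iff_tendsto_nat_of_nonneg fun j => by positivity]
  have hsum (n : ℕ) : ∑ j ∈ Finset.range n, 1 / (L * ((j + a) * (j + a + 1))) =
      1 / (L * a) - 1 / (L * (n + a)) := by
    induction n with
    | zero => simp
    | succ n ih =>
      rw [Finset.sum_range_succ, ih]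
      push_cast
      field_simp
      ring
  simp_rw [hsum]
  have hlim : Tendsto (fun n : ℕ => 1 / (L * (n + a))) atTop (nhds 0) := by
    simp_rw [one_div]
    exact tendsto_inv_atTop_zero.comp
      ((tendsto_natCast_atTop_atTop.atTop_add tendsto_const_nhds).const_mul_atTop hL)
  simpa using tendsto_const_nhds.sub hlim

theorem gaussMeasure_apply (N : ℕ) {s : Set ℝ} (hs : MeasurableSet s) :
    gaussMeasure N s =
      ∫⁻ x in Ioc 0 1, s.indicator (fun x => ENNReal.ofReal (gaussDensity N x)) x := by
  rw [gaussMeasure, withDensity_apply _ hs, lintegral_indicator hs]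

theorem measurePreserving_gaussT {N : ℕ} (hN : 0 < N) :
    MeasurePreserving (gaussT N) (gaussMeasure N) (gaussMeasure N) := by
  have hN' : (0 : ℝ) < N := by exact_mod_cast hN
  have hL := log_one_add_one_div_natCast_pos hN
  refine ⟨measurable_gaussT N, Measure.ext fun s hs => ?_⟩
  rw [Measure.map_apply (measurable_gaussT N) hs,
    gaussMeasure_apply N (measurable_gaussT N hs), gaussMeasure_apply N hs,
    ← iUnion_Ioc_natCast_div hN, lintegral_iUnion (fun _ => measurableSet_Ioc)
      (pairwise_disjoint_Ioc_natCast_div hN), iUnion_Ioc_natCast_div hN,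
    ← setLIntegral_congr (Ico_ae_eq_Ioc (μ := volume) (a := (0 : ℝ)) (b := 1))]
  have hbranch (j : ℕ) :
      ∫⁻ x in Ioc ((N : ℝ) / ((j + N : ℕ) + 1)) (N / (j + N : ℕ)),
        (gaussT N ⁻¹' s).indicator (fun x => ENNReal.ofReal (gaussDensity N x)) x =
      ∫⁻ y in Ico 0 1, s.indicator (fun y => ENNReal.ofReal
        (1 / (Real.log (1 + 1 / (N : ℝ)) * ((j + (N + y)) * (j + (N + y) + 1))))) y := by
    rw [lintegral_Ioc_natCast_div hN (by lia)]
    refine setLIntegral_congr_fun measurableSet_Ico fun y hy => ?_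
    have hy0 := hy.1
    by_cases hys : y ∈ s
    · rw [indicator_of_mem hys, indicator_of_mem
        (by rwa [mem_preimage, gaussT_div_add hN (by lia) hy]),
        ← ENNReal.ofReal_mul (by positivity), gaussDensity]
      congr 1
      push_cast
      have h1 : (j : ℝ) + N + y ≠ 0 := by positivity
      have h2 : (j : ℝ) + (N + y) ≠ 0 := by positivity
      have h3 : (j : ℝ) + (N + y) + 1 ≠ 0 := by positivity
      have h4 : (N : ℝ) + N / (j + N + y) ≠ 0 := by positivity
      have h5 : (N : ℝ) + N / (j + N + y) = N * (j + (N + y) + 1) / (j + (N + y)) := by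
        rw [← add_assoc]
        field_simp
      rw [h5, ← add_assoc]
      field_simp
    · rw [indicator_of_notMem hys, indicator_of_notMem
        (by rwa [mem_preimage, gaussT_div_add hN (by lia) hy]), mul_zero]
  simp_rw [hbranch]
  rw [← lintegral_tsum fun j => (Measurable.indicator (by fun_prop) hs).aemeasurable]
  refine setLIntegral_congr_fun measurableSet_Ico fun y hy => ?_
  by_cases hys : y ∈ s
  · have hsum := hasSum_one_div_mul_add_one hL (a := N + y) (by linarith [hy.1])
    simp_rw [indicator_of_mem hys]
    have hy0 := hy.1
    rw [← ENNReal.ofReal_tsum_of_nonneg (fun j => by positivity) hsum.summable, hsum.tsum_eq,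
      gaussDensity]
  · simp [indicator_of_notMem hys]

theorem gaussMeasure_Ioc {N : ℕ} (hN : 0 < N) {a b : ℝ} (ha : 0 ≤ a) (hab : a ≤ b) (hb : b ≤ 1) :
    gaussMeasure N (Ioc a b) = ENNReal.ofReal
      ((Real.log (N + b) - Real.log (N + a)) / Real.log (1 + 1 / (N : ℝ))) := by
  have hN' : (0 : ℝ) < N := by exact_mod_cast hN
  have hL := log_one_add_one_div_natCast_pos hN
  have hpos {x : ℝ} (hx : x ∈ Icc a b) : 0 < N + x := by linarith [hx.1]
  have hcont : ContinuousOn (gaussDensity N) (Icc a b) :=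
    continuousOn_const.div (by fun_prop) fun x hx => (mul_pos hL (hpos hx)).ne'
  have hintegral : ∫ x in a..b, gaussDensity N x =
      Real.log (N + b) / Real.log (1 + 1 / (N : ℝ)) -
        Real.log (N + a) / Real.log (1 + 1 / (N : ℝ)) := by
    refine intervalIntegral.integral_eq_sub_of_hasDerivAt
      (f := fun x => Real.log (N + x) / Real.log (1 + 1 / (N : ℝ))) (fun x hx => ?_)
      (ContinuousOn.intervalIntegrable (by rwa [uIcc_of_le hab]))
    rw [uIcc_of_le hab] at hx
    have h := (((hasDerivAt_id x).const_add (N : ℝ)).log (hpos hx).ne').div_const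
      (Real.log (1 + 1 / (N : ℝ)))
    refine h.congr_deriv ?_
    rw [gaussDensity, id, div_div, mul_comm]
  rw [gaussMeasure, withDensity_apply _ measurableSet_Ioc,
    Measure.restrict_restrict measurableSet_Ioc,
    inter_eq_left.2 (Ioc_subset_Ioc ha hb), sub_div, ← hintegral,
    intervalIntegral.integral_of_le hab, ofReal_integral_eq_lintegral_ofReal
      ((hcont.integrableOn_Icc).mono_set Ioc_subset_Icc_self)]
  filter_upwards [ae_restrict_mem measurableSet_Ioc] with x hx
  exact (gaussDensity_pos hN (ha.trans hx.1.le)).le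

theorem gaussMeasure_absolutelyContinuous (N : ℕ) :
    gaussMeasure N ≪ volume.restrict (Ioc 0 1) :=
  withDensity_absolutelyContinuous _ _

theorem absolutelyContinuous_gaussMeasure {N : ℕ} (hN : 0 < N) :
    volume.restrict (Ioc 0 1) ≪ gaussMeasure N := by
  refine withDensity_absolutelyContinuous'
    (measurable_gaussDensity N).ennreal_ofReal.aemeasurable ?_
  filter_upwards [ae_restrict_mem measurableSet_Ioc] with x hx
  simpa using gaussDensity_pos hN hx.1.le

theorem isProbabilityMeasure_gaussMeasure {N : ℕ} (hN : 0 < N) :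
    IsProbabilityMeasure (gaussMeasure N) := by
  have hN' : (0 : ℝ) < N := by exact_mod_cast hN
  have hL := log_one_add_one_div_natCast_pos hN
  have hcompl : gaussMeasure N (Ioc 0 1)ᶜ = 0 :=
    gaussMeasure_absolutelyContinuous N (by simp [Measure.restrict_apply measurableSet_Ioc.compl])
  refine ⟨?_⟩
  rw [← measure_add_measure_compl (measurableSet_Ioc (a := (0 : ℝ)) (b := 1)), hcompl, add_zero,
    gaussMeasure_Ioc hN le_rfl zero_le_one le_rfl, add_zero,
    ← Real.log_div (by positivity) hN'.ne', add_div, div_self hN'.ne', div_self hL.ne',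
    ENNReal.ofReal_one]

theorem ergodic_gaussT {N : ℕ} (hN : 0 < N) : Ergodic (gaussT N) (gaussMeasure N) := by
  refine ⟨measurePreserving_gaussT hN, ⟨fun s hsm hs => ?_⟩⟩
  have hnull {t : Set ℝ} (htm : MeasurableSet t) (ht : volume (t ∩ Ioo 0 1) = 0) :
      gaussMeasure N t = 0 := by
    refine gaussMeasure_absolutelyContinuous N ?_
    rwa [← restrict_Ioo_eq_restrict_Ioc, Measure.restrict_apply htm]
  rw [eventuallyConst_set', ae_eq_empty, ae_eq_univ]
  exact (volume_inter_eq_zero_or_compl_of_gaussT_invariant hN hsm hs).imp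
    (hnull hsm) (hnull hsm.compl)

theorem measurable_floor_div_rpow (N : ℕ) (r : ℝ) :
    Measurable fun x : ℝ => (⌊(N : ℝ) / x⌋ : ℝ) ^ r :=
  ((measurable_from_top (f := fun z : ℤ => (z : ℝ))).comp
    (Int.measurable_floor.comp (measurable_const.div measurable_id))).pow_const r

theorem integrable_floor_div_rpow {N : ℕ} (hN : 0 < N) {r : ℝ} (hr : r < 1) :
    Integrable (fun x : ℝ => (⌊(N : ℝ) / x⌋ : ℝ) ^ r) (gaussMeasure N) := by
  have hN' : (1 : ℝ) ≤ N := by exact_mod_cast hN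
  have hL := log_one_add_one_div_natCast_pos hN
  have hbase : IntegrableOn (fun x : ℝ => (⌊(N : ℝ) / x⌋ : ℝ) ^ r) (Ioc 0 1) := by
    have hpow : IntegrableOn (fun x : ℝ => (N : ℝ) ^ |r| * x ^ (-max r 0)) (Ioc 0 1) := by
      have h : IntervalIntegrable (fun x : ℝ => x ^ (-max r 0)) volume 0 1 :=
        intervalIntegral.intervalIntegrable_rpow' (by
          have := max_lt hr zero_lt_one
          linarith)
      exact ((intervalIntegrable_iff_integrableOn_Ioc_of_le zero_le_one).1 h).const_mul _
    refine hpow.mono' (measurable_floor_div_rpow N r).aestronglyMeasurable ?_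
    filter_upwards [ae_restrict_mem measurableSet_Ioc] with x hx
    have hge : (1 : ℝ) ≤ N / x := by
      rw [le_div_iff₀ hx.1]
      linarith [hx.2]
    have hfl : (1 : ℝ) ≤ ⌊(N : ℝ) / x⌋ := by
      exact_mod_cast Int.le_floor.2 (by simpa using hge)
    rw [Real.norm_eq_abs, abs_of_nonneg (by positivity)]
    rcases le_total r 0 with h | h
    · rw [max_eq_right h, neg_zero, Real.rpow_zero, mul_one]
      exact (Real.rpow_le_one_of_one_le_of_nonpos hfl h).trans
        (Real.one_le_rpow hN' (abs_nonneg r))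
    · rw [max_eq_left h, abs_of_nonneg h, Real.rpow_neg hx.1.le, ← div_eq_mul_inv,
        ← Real.div_rpow (by positivity) hx.1.le]
      exact Real.rpow_le_rpow (by positivity) (Int.floor_le _) h
  rw [gaussMeasure, integrable_withDensity_iff_integrable_smul'
    (measurable_gaussDensity N).ennreal_ofReal (by simp)]
  refine Integrable.bdd_mul (c := gaussDensity N 0) hbase
    (measurable_gaussDensity N).ennreal_ofReal.ennreal_toReal.aestronglyMeasurable ?_
  filter_upwards [ae_restrict_mem measurableSet_Ioc] with x hx
  have hd := (gaussDensity_pos hN hx.1.le).le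
  rw [ENNReal.toReal_ofReal hd, Real.norm_eq_abs, abs_of_nonneg hd, gaussDensity, gaussDensity]
  gcongr
  exact hx.1.le

theorem hasSum_integral_floor_div_rpow {N : ℕ} (hN : 0 < N) {r : ℝ} (hr : r < 1) :
    HasSum (fun j : ℕ => ((j : ℝ) + N) ^ r *
        ((Real.log (1 + 1 / ((j : ℝ) + N)) - Real.log (1 + 1 / ((j : ℝ) + N + 1))) /
          Real.log (1 + 1 / (N : ℝ))))
      (∫ x, (⌊(N : ℝ) / x⌋ : ℝ) ^ r ∂gaussMeasure N) := by
  have hN' : (0 : ℝ) < N := by exact_mod_cast hN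
  have hL := log_one_add_one_div_natCast_pos hN
  have h := hasSum_integral_iUnion (fun _ => measurableSet_Ioc)
    (pairwise_disjoint_Ioc_natCast_div hN) (integrable_floor_div_rpow hN hr).integrableOn
  have hres : (gaussMeasure N).restrict (Ioc 0 1) = gaussMeasure N :=
    Measure.restrict_eq_self_of_ae_mem
      ((gaussMeasure_absolutelyContinuous N).ae_le (ae_restrict_mem measurableSet_Ioc))
  rw [iUnion_Ioc_natCast_div hN, hres] at h
  convert! h using 1
  funext j
  have hjN : (0 : ℝ) < j + N := by positivity
  have hle : (N : ℝ) / (j + N + 1) ≤ N / (j + N) :=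
    div_le_div_of_nonneg_left hN'.le hjN (by linarith)
  have hlog : Real.log (1 + 1 / ((j : ℝ) + N)) - Real.log (1 + 1 / ((j : ℝ) + N + 1)) =
      Real.log (N + N / (j + N)) - Real.log (N + N / (j + N + 1)) := by
    have h1 (a : ℝ) (ha : 0 < a) :
        Real.log (N + N / a) = Real.log N + Real.log (1 + 1 / a) := by
      rw [← Real.log_mul hN'.ne' (by positivity)]
      ring_nf
    rw [h1 _ hjN, h1 _ (by positivity)]
    ring
  rw [setIntegral_congr_fun (g := fun _ => ((j : ℝ) + N) ^ r) measurableSet_Ioc fun x hx => by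
      simp [floor_div_eq_of_mem_Ioc hN (by lia) hx],
    setIntegral_const, smul_eq_mul, mul_comm, measureReal_def, Nat.cast_add,
    gaussMeasure_Ioc hN (by positivity) hle ((div_le_one hjN).2 (by simp)),
    ENNReal.toReal_ofReal, hlog]
  refine div_nonneg (sub_nonneg.2 (Real.log_le_log (by positivity) ?_)) hL.le
  linarith

theorem integral_floor_div_rpow_pos {N : ℕ} (hN : 0 < N) {r : ℝ} (hr : r < 1) :
    0 < ∫ x, (⌊(N : ℝ) / x⌋ : ℝ) ^ r ∂gaussMeasure N := by
  have hL := log_one_add_one_div_natCast_pos hN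
  have hpos (j : ℕ) : 0 < ((j : ℝ) + N) ^ r *
      ((Real.log (1 + 1 / ((j : ℝ) + N)) - Real.log (1 + 1 / ((j : ℝ) + N + 1))) /
        Real.log (1 + 1 / (N : ℝ))) := by
    refine mul_pos (by positivity) (div_pos (sub_pos.2 (Real.log_lt_log (by positivity) ?_)) hL)
    linarith [one_div_lt_one_div_of_lt (show (0 : ℝ) < j + N by positivity) (lt_add_one _)]
  have h := hasSum_integral_floor_div_rpow hN hr
  exact h.tsum_eq ▸ h.summable.tsum_pos (fun j => (hpos j).le) 0 (hpos 0)

/-- For every real `r < 1`, `r ≠ 0`, and Lebesgue almost every `x ∈ [0,1)`, the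
`r`-Hölder mean of the `N`-continued fraction coefficients `a_k = ⌊N / T_N^[k-1] x⌋`
of `x` converges to `K_{N,r}`. -/
theorem gaussT_coeff_holder_mean (N : ℕ) (hN : 0 < N) (r : ℝ) (hr : r < 1) (hr0 : r ≠ 0) :
    ∀ᵐ x ∂(volume.restrict (Set.Ico (0:ℝ) 1)),
      Tendsto (fun n : ℕ =>
          ((1 / (n : ℝ)) *
            ∑ j ∈ Finset.range n, (⌊(N : ℝ) / (gaussT N)^[j] x⌋ : ℝ) ^ r) ^ (1 / r))
        atTop (nhds (holderConst N r)) := by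
  have := isProbabilityMeasure_gaussMeasure hN
  have hae := (ergodic_gaussT hN).ae_tendsto_birkhoffSum_div (measurable_floor_div_rpow N r)
    (integrable_floor_div_rpow hN hr)
  rw [Measure.restrict_congr_set (Ico_ae_eq_Ioc (μ := volume) (a := (0 : ℝ)) (b := 1))]
  filter_upwards [(absolutelyContinuous_gaussMeasure hN).ae_le hae] with x hx
  rw [holderConst, (hasSum_integral_floor_div_rpow hN hr).tsum_eq]
  refine Tendsto.rpow_const ?_ (Or.inl (integral_floor_div_rpow_pos hN hr).ne')
  refine hx.congr fun n => ?_
  rw [birkhoffSum, div_eq_inv_mul, one_div]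
end

section
/- For every real r < 1 with r ≠ 0, the constants K_{N,r} = (Σ_{k=N}^∞ k^r · (ln(1+1/k) − ln(1+1/(k+1)))/ln(1+1/N))^{1/r} satisfy lim_{N→∞} K_{N,r}/N = (1 − r)^{−1/r}. -/
open Filter

/-- A Stolz–Cesàro theorem for tails of series: if `t k` is asymptotically `c` times the
decrement of a sequence `B` that decreases to `0`, then the tails of `∑ t k` are asymptotically
`c` times `B`. -/
theorem tendsto_tsum_tail_div {t B : ℕ → ℝ} {c : ℝ} (hB : ∀ᶠ k in atTop, B (k + 1) < B k)
    (hB0 : Tendsto B atTop (nhds 0))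
    (ht : Tendsto (fun k => t k / (B k - B (k + 1))) atTop (nhds c)) :
    Tendsto (fun N => (∑' j, t (j + N)) / B N) atTop (nhds c) := by
  rw [Metric.tendsto_atTop'] at ht ⊢
  intro ε hε
  obtain ⟨M, hM⟩ := ht (ε / 2) (half_pos hε)
  obtain ⟨M', hM'⟩ := eventually_atTop.1 hB
  refine ⟨max M M', fun N hN => ?_⟩
  have hN1 : M < N := (le_max_left _ _).trans_lt hN
  have hN2 : M' < N := (le_max_right _ _).trans_lt hN
  have hpos : ∀ j, 0 < B (j + N) - B (j + N + 1) := fun j => sub_pos.2 (hM' _ (by omega))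
  have hsum : HasSum (fun j => B (j + N) - B (j + N + 1)) (B N) := by
    rw [hasSum_iff_tendsto_nat_of_nonneg (fun j => (hpos j).le)]
    have h : ∀ n, ∑ j ∈ Finset.range n, (B (j + N) - B (j + N + 1)) = B N - B (n + N) := by
      intro n
      have := Finset.sum_range_sub' (fun j => B (j + N)) n
      simpa [add_right_comm] using this
    simp only [h]
    simpa using (tendsto_const_nhds (x := B N)).sub (hB0.comp (tendsto_add_atTop_nat N))
  have hbound : ∀ j, ‖t (j + N) - c * (B (j + N) - B (j + N + 1))‖ ≤
      ε / 2 * (B (j + N) - B (j + N + 1)) := by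
    intro j
    have h := (hM (j + N) (by omega)).le
    have hp := hpos j
    have heq : t (j + N) - c * (B (j + N) - B (j + N + 1)) =
        (t (j + N) / (B (j + N) - B (j + N + 1)) - c) * (B (j + N) - B (j + N + 1)) := by
      field_simp
    rw [heq, norm_mul, Real.norm_of_nonneg hp.le]
    exact mul_le_mul_of_nonneg_right h hp.le
  have hdiff : Summable fun j => t (j + N) - c * (B (j + N) - B (j + N + 1)) :=
    (hsum.mul_left (ε / 2)).summable.of_norm_bounded hbound
  have htsum := hdiff.hasSum.add (hsum.mul_left c)
  simp only [sub_add_cancel] at htsum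
  have hle := tsum_of_norm_bounded (hsum.mul_left (ε / 2)) hbound
  have hBN : 0 < B N := by
    have h1 := hsum.tsum_eq ▸ hsum.summable.tsum_pos (fun j => (hpos j).le) 0 (hpos 0)
    exact h1
  rw [htsum.tsum_eq, Real.dist_eq, add_div, mul_div_cancel_right₀ _ hBN.ne', add_sub_cancel_right,
    abs_div, abs_of_pos hBN, div_lt_iff₀ hBN]
  calc _ ≤ ε / 2 * B N := hle
    _ < ε * B N := by gcongr; linarith

theorem tendsto_natCast_mul_log_one_add_inv :
    Tendsto (fun N : ℕ => (N : ℝ) * Real.log (1 + 1 / (N : ℝ))) atTop (nhds 1) :=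
  (Real.tendsto_mul_log_one_add_div_atTop 1).comp tendsto_natCast_atTop_atTop

theorem tendsto_sq_mul_log_one_add_inv_sub :
    Tendsto (fun k : ℕ => (k : ℝ) ^ 2 *
      (Real.log (1 + 1 / (k : ℝ)) - Real.log (1 + 1 / ((k : ℝ) + 1)))) atTop (nhds 1) := by
  have hk : Tendsto (fun k : ℕ => (k : ℝ)) atTop atTop := tendsto_natCast_atTop_atTop
  have h1 : Tendsto (fun k : ℕ => (k : ℝ) * (k + 2)) atTop atTop :=
    hk.atTop_mul_atTop₀ (tendsto_atTop_add_const_right _ _ hk)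
  have h2 := (Real.tendsto_mul_log_one_add_div_atTop 1).comp h1
  have h3 : Tendsto (fun k : ℕ => (1 + 2 / (k : ℝ))⁻¹) atTop (nhds 1) := by
    simpa using ((hk.const_div_atTop 2).const_add 1).inv₀ (by simp)
  refine (by simpa using h3.mul h2 : Tendsto _ atTop (nhds (1 : ℝ))).congr' ?_
  filter_upwards [eventually_gt_atTop 0] with k hk0
  have hk1 : (0 : ℝ) < k := by exact_mod_cast hk0
  rw [← Real.log_div (by positivity) (by positivity)]
  have : (1 + 1 / (k : ℝ)) / (1 + 1 / ((k : ℝ) + 1)) = 1 + 1 / ((k : ℝ) * (k + 2)) := by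
    field_simp
    ring
  rw [this]
  field_simp

theorem tendsto_mul_one_sub_one_add_inv_rpow (s : ℝ) :
    Tendsto (fun k : ℕ => (k : ℝ) * (1 - (1 + 1 / (k : ℝ)) ^ s)) atTop (nhds (-s)) := by
  have hd : HasDerivAt (fun x : ℝ => x ^ s) s 1 := by
    simpa using Real.hasDerivAt_rpow_const (x := 1) (p := s) (Or.inl one_ne_zero)
  have h0 : Tendsto (fun k : ℕ => 1 / (k : ℝ)) atTop (nhdsWithin 0 {0}ᶜ) := by
    refine tendsto_nhdsWithin_iff.2 ⟨tendsto_one_div_atTop_nhds_zero_nat, ?_⟩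
    filter_upwards [eventually_gt_atTop 0] with k hk0
    have : k ≠ 0 := hk0.ne'
    simpa using this
  refine ((hasDerivAt_iff_tendsto_slope_zero.1 hd).comp h0).neg.congr fun k => ?_
  simp
  ring

theorem tendsto_rpow_mul_log_sub_div (r : ℝ) (hr : r < 1) :
    Tendsto (fun k : ℕ => (k : ℝ) ^ r *
      (Real.log (1 + 1 / (k : ℝ)) - Real.log (1 + 1 / ((k : ℝ) + 1))) /
        ((k : ℝ) ^ (r - 1) - ((k + 1 : ℕ) : ℝ) ^ (r - 1))) atTop (nhds (1 - r)⁻¹) := by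
  have h := tendsto_sq_mul_log_one_add_inv_sub.div (tendsto_mul_one_sub_one_add_inv_rpow (r - 1))
    (by linarith)
  rw [neg_sub, one_div] at h
  refine h.congr' ?_
  filter_upwards [eventually_gt_atTop 0] with k hk0
  have hk1 : (0 : ℝ) < k := by exact_mod_cast hk0
  have e1 : ((k + 1 : ℕ) : ℝ) ^ (r - 1) = (k : ℝ) ^ (r - 1) * (1 + 1 / (k : ℝ)) ^ (r - 1) := by
    rw [← Real.mul_rpow hk1.le (by positivity)]
    congr 1
    push_cast
    field_simp
  have e2 : (k : ℝ) ^ r = (k : ℝ) ^ (r - 1) * k := by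
    rw [← Real.rpow_add_one hk1.ne', sub_add_cancel]
  have hp : (k : ℝ) ^ (r - 1) ≠ 0 := (Real.rpow_pos_of_pos hk1 _).ne'
  simp only [Pi.div_apply]
  rw [e1, e2, ← mul_one_sub, mul_assoc, mul_div_mul_left _ _ hp, pow_two, mul_assoc,
    mul_div_mul_left _ _ hk1.ne']

/-- For every real `r < 1` with `r ≠ 0`, `lim_{N→∞} K_{N,r} / N = (1 - r)^(-1/r)`. -/
theorem holderConst_limit (r : ℝ) (hr : r < 1) (hr0 : r ≠ 0) :
    Tendsto (fun N : ℕ => holderConst N r / N) atTop (nhds ((1 - r) ^ (-1 / r))) := by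
  have hr1 : 0 < 1 - r := sub_pos.2 hr
  have htail := tendsto_tsum_tail_div (B := fun k : ℕ => (k : ℝ) ^ (r - 1))
    (by
      filter_upwards [eventually_gt_atTop 0] with k hk0
      exact Real.rpow_lt_rpow_of_neg (by exact_mod_cast hk0) (by simp) (by linarith))
    (by
      have := (tendsto_rpow_neg_atTop hr1).comp (tendsto_natCast_atTop_atTop (R := ℝ))
      simpa [Function.comp_def] using this)
    (tendsto_rpow_mul_log_sub_div r hr)
  have hlim := (htail.div tendsto_natCast_mul_log_one_add_inv one_ne_zero).rpow_const
    (p := 1 / r) (Or.inl (by simpa using hr1.ne'))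
  have hval : ((1 - r)⁻¹ / 1) ^ (1 / r) = (1 - r) ^ (-1 / r) := by
    rw [div_one, Real.inv_rpow hr1.le, neg_div, Real.rpow_neg hr1.le]
  rw [hval] at hlim
  refine hlim.congr' ?_
  filter_upwards [eventually_gt_atTop 0] with N hN0
  have hN : (0 : ℝ) < N := by exact_mod_cast hN0
  have hlog : 0 < Real.log (1 + 1 / (N : ℝ)) := Real.log_pos (by simpa using hN0)
  have hnonneg : 0 ≤ ∑' j : ℕ, ((j : ℝ) + N) ^ r *
      (Real.log (1 + 1 / ((j : ℝ) + N)) - Real.log (1 + 1 / ((j : ℝ) + N + 1))) := by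
    refine tsum_nonneg fun j => mul_nonneg (by positivity) (sub_nonneg.2 ?_)
    exact Real.log_le_log (by positivity) (add_le_add_right
      (one_div_le_one_div_of_le (by positivity) (le_add_of_nonneg_right zero_le_one)) 1)
  have hNr : (N : ℝ) = ((N : ℝ) ^ r) ^ (1 / r) := by
    rw [← Real.rpow_mul hN.le, mul_one_div_cancel hr0, Real.rpow_one]
  have e2 : (N : ℝ) ^ r = (N : ℝ) ^ (r - 1) * N := by
    rw [← Real.rpow_add_one hN.ne', sub_add_cancel]
  simp only [holderConst, Pi.div_apply, ← mul_div_assoc, tsum_div_const, Nat.cast_add]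
  conv_rhs => enter [2]; rw [hNr]
  rw [← Real.div_rpow (div_nonneg hnonneg hlog.le) (by positivity), e2]
  congr 1
  simp only [add_assoc]
  field_simp
end
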